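/- For generic polynomials f_1, …, f_n : ℂ^m → ℂ with n ≤ m and each f_i non-constant: the set of coefficient tuples for which the system f_1 = ⋯ = f_n = 0 has a common solution in ℂ^m contains a Zariski-open dense subset of coefficient space (for fixed degrees d_i ≥ 1, the resultant-type obstruction vanishes on a dense open set; in fact for n ≤ m a common zero exists whenever the f_i are nonconstant, by intersecting hypersurfaces in projective space and checking the intersection is not entirely at infinity for generic coefficients). -/

import Mathlib

open MvPolynomial

/-- Generic surjectivity of an injective map of polynomial rings (via Chevalley). -/
theorem aux_generic_surj {σ τ : Type} [Finite σ] [Finite τ]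
    (φ : MvPolynomial σ ℂ →ₐ[ℂ] MvPolynomial τ ℂ) (hφ : Function.Injective φ) :
    ∃ P : MvPolynomial σ ℂ, P ≠ 0 ∧ ∀ x : σ → ℂ, eval x P ≠ 0 →
      ∃ z : τ → ℂ, ∀ s, eval z (φ (X s)) = x s := by
  have hft : (φ : MvPolynomial σ ℂ →+* MvPolynomial τ ℂ).FiniteType := by
    have h : ((φ : MvPolynomial σ ℂ →+* MvPolynomial τ ℂ).comp
        (algebraMap ℂ (MvPolynomial σ ℂ))).FiniteType := by
      rw [AlgHom.comp_algebraMap]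
      exact RingHom.finiteType_algebraMap.mpr inferInstance
    exact RingHom.FiniteType.of_comp_finiteType h
  have hfp : (φ : MvPolynomial σ ℂ →+* MvPolynomial τ ℂ).FinitePresentation :=
    (RingHom.FinitePresentation.of_finiteType).mp hft
  obtain ⟨S, hS⟩ := PrimeSpectrum.exists_constructibleSetData_iff.mpr
    (PrimeSpectrum.isConstructible_range_comap hfp)
  let b : PrimeSpectrum (MvPolynomial σ ℂ) := ⟨⊥, Ideal.isPrime_bot⟩
  have hb : b ∈ S.toSet := by
    rw [hS]
    refine ⟨⟨⊥, Ideal.isPrime_bot⟩, ?_⟩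
    ext p
    simp [b, map_eq_zero_iff φ hφ]
  simp only [PrimeSpectrum.ConstructibleSetData.toSet, Set.mem_iUnion] at hb
  obtain ⟨D, hD, hg, hf⟩ := hb
  have hg0 : ∀ i, D.g i = 0 := fun i => by
    have := hg (Set.mem_range_self i)
    simpa [b] using this
  have hf0 : D.f ≠ 0 := by
    intro h
    apply hf
    simp [b, h]
  refine ⟨D.f, hf0, fun x hx => ?_⟩
  let m : PrimeSpectrum (MvPolynomial σ ℂ) := ⟨vanishingIdeal ℂ {x}, inferInstance⟩
  have hm : m ∈ S.toSet := by
    simp only [PrimeSpectrum.ConstructibleSetData.toSet, Set.mem_iUnion]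
    refine ⟨D, hD, ?_, ?_⟩
    · rintro _ ⟨i, rfl⟩
      simp [hg0]
    · intro h
      have h1 : D.f ∈ vanishingIdeal ℂ {x} := h rfl
      rw [mem_vanishingIdeal_singleton_iff] at h1
      exact hx (by simpa [aeval_eq_eval] using h1)
  rw [hS] at hm
  obtain ⟨q, hq⟩ := hm
  obtain ⟨M, hM, hqM⟩ := q.asIdeal.exists_le_maximal q.2.ne_top
  obtain ⟨z, rfl⟩ := isMaximal_iff_eq_vanishingIdeal_singleton.mp hM
  refine ⟨z, fun s => ?_⟩
  have h1 : (X s - C (x s) : MvPolynomial σ ℂ) ∈ m.asIdeal := by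
    change _ ∈ vanishingIdeal ℂ {x}
    rw [mem_vanishingIdeal_singleton_iff]
    simp
  rw [← hq] at h1
  have h2 : φ (X s - C (x s)) ∈ vanishingIdeal ℂ {z} := hqM h1
  rw [mem_vanishingIdeal_singleton_iff] at h2
  have h3 : φ (C (x s)) = C (x s) := φ.commutes (x s)
  rw [map_sub, h3, map_sub, aeval_C] at h2
  simpa [aeval_eq_eval, sub_eq_zero] using h2

/-- A polynomial map with surjective derivative at one point is dominant. -/
theorem aux_dominant {σ τ : Type} [Fintype σ] [Fintype τ]
    (F : σ → MvPolynomial τ ℂ) (z₀ : τ → ℂ)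
    (h : ∀ u : σ → ℂ, ∃ v w : τ → ℂ, ∃ a b : σ → ℂ, a + b = u ∧
      (∀ t : ℂ, ∀ s, eval (z₀ + t • v) (F s) = eval z₀ (F s) + t * a s) ∧
      (∀ t : ℂ, ∀ s, eval (z₀ + t • w) (F s) = eval z₀ (F s) + t * b s)) :
    Function.Injective (aeval F : MvPolynomial σ ℂ →ₐ[ℂ] MvPolynomial τ ℂ) := by
  let G : (τ → ℂ) → (σ → ℂ) := fun z s => eval z (F s)
  have hG : HasStrictFDerivAt G (fderiv ℂ G z₀) z₀ := by
    have : AnalyticAt ℂ G z₀ := by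
      rw [analyticAt_pi_iff]
      intro s
      exact AnalyticOnNhd.eval_mvPolynomial (F s) z₀ (Set.mem_univ _)
    exact this.hasStrictFDerivAt
  have key : ∀ (v : τ → ℂ) (a : σ → ℂ),
      (∀ t : ℂ, ∀ s, eval (z₀ + t • v) (F s) = eval z₀ (F s) + t * a s) →
      fderiv ℂ G z₀ v = a := by
    intro v a hv
    have h1 : HasLineDerivAt ℂ G (fderiv ℂ G z₀ v) z₀ v := hG.hasFDerivAt.hasLineDerivAt v
    have h2 : HasLineDerivAt ℂ G a z₀ v := by
      have e : (fun t : ℂ => G (z₀ + t • v)) = fun t => G z₀ + t • a := by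
        funext t s
        exact hv t s
      unfold HasLineDerivAt
      rw [e]
      simpa using ((hasDerivAt_id (0 : ℂ)).smul_const a).const_add (G z₀)
    exact h1.unique h2
  have hsurj : (fderiv ℂ G z₀).range = ⊤ := by
    rw [LinearMap.range_eq_top]
    intro u
    obtain ⟨v, w, a, b, hab, hv, hw⟩ := h u
    refine ⟨v + w, ?_⟩
    have := map_add (fderiv ℂ G z₀) v w
    rw [key v a hv, key w b hw, hab] at this
    exact this
  have hmap := hG.map_nhds_eq_of_surj hsurj
  rw [injective_iff_map_eq_zero]
  intro P hP
  have hz : ∀ z, eval (G z) P = 0 := by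
    intro z
    have : eval z (aeval F P) = 0 := by rw [hP]; simp
    rw [← this]
    have e : ((aeval z : MvPolynomial τ ℂ →ₐ[ℂ] ℂ).comp (aeval F)) = aeval (G z) := by
      ext s; simp [G, aeval_eq_eval]
    have := DFunLike.congr_fun e P
    simpa [aeval_eq_eval] using this.symm
  have hn : Set.range G ∈ nhds (G z₀) := by
    rw [← hmap]
    exact Filter.range_mem_map
  obtain ⟨ε, hε, hball⟩ := Metric.mem_nhds_iff.mp hn
  refine funext_set (fun s => Metric.ball (G z₀ s) ε) (fun s => ?_) fun x hx => ?_
  · exact infinite_of_mem_nhds _ (Metric.ball_mem_nhds _ hε)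
  · have : x ∈ Metric.ball (G z₀) ε := by
      rw [ball_pi _ hε]; exact hx
    obtain ⟨z, rfl⟩ := hball this
    simp [hz]

theorem generic_underdetermined_system_has_solution (n m : ℕ) (hnm : n ≤ m)
    (d : Fin n → ℕ) (hd : ∀ i, 1 ≤ d i) :
    ∃ P : MvPolynomial (Fin n × (Fin m →₀ ℕ)) ℂ, P ≠ 0 ∧
      (∀ p ∈ P.vars, (p.2.sum fun _ e => e) ≤ d p.1) ∧
      ∀ f : Fin n → MvPolynomial (Fin m) ℂ,
        (∀ i, (f i).totalDegree ≤ d i) → (∀ i, (f i).totalDegree ≠ 0) →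
        eval (fun p => coeff p.2 (f p.1)) P ≠ 0 →
        ∃ y : Fin m → ℂ, ∀ i, eval y (f i) = 0 := by
  classical
  have hfin : ∀ i, {s : Fin m →₀ ℕ | (s.sum fun _ e => e) ≤ d i}.Finite := fun i =>
    Finsupp.finite_of_degree_le (d i)
  let S : Fin n → Finset (Fin m →₀ ℕ) := fun i => (hfin i).toFinset
  have hS : ∀ i s, s ∈ S i ↔ (s.sum fun _ e => e) ≤ d i := fun i s => by simp [S]
  let σ : Type := {p : Fin n × (Fin m →₀ ℕ) // p.2 ∈ S p.1}
  have : Finite σ := by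
    have : Finite (Σ i, S i) := inferInstance
    refine Finite.of_injective (β := Σ i, S i) (fun p => ⟨p.1.1, p.1.2, p.2⟩) ?_
    rintro ⟨⟨i, s⟩, h⟩ ⟨⟨i', s'⟩, h'⟩ e
    simp only [Sigma.mk.injEq] at e
    obtain ⟨rfl, e⟩ := e
    have e' : s = s' := by simpa using e
    subst e'
    rfl
  have : Fintype σ := Fintype.ofFinite σ
  let v : Fin n × (Fin m →₀ ℕ) → MvPolynomial (σ ⊕ Fin m) ℂ := fun p =>
    if h : p.2 ∈ S p.1 then X (Sum.inl ⟨p, h⟩) else 0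
  let F : σ → MvPolynomial (σ ⊕ Fin m) ℂ := fun p =>
    if p.1.2 = 0 then
      - ∑ s ∈ (S p.1.1).erase 0, v (p.1.1, s) * ∏ j, X (Sum.inr j) ^ s j
    else X (Sum.inl p)
  have hv : ∀ z p (h : p.2 ∈ S p.1), eval z (v p) = z (Sum.inl ⟨p, h⟩) := by
    intro z p h; simp [v, h]
  have hF0 : ∀ z (p : σ), p.1.2 = 0 → eval z (F p) =
      - ∑ s ∈ (S p.1.1).erase 0, eval z (v (p.1.1, s)) * ∏ j, z (Sum.inr j) ^ s j := by
    intro z p hp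
    simp only [F, if_pos hp]
    simp [map_sum, map_prod]
  have hF1 : ∀ z (p : σ), p.1.2 ≠ 0 → eval z (F p) = z (Sum.inl p) := by
    intro z p hp
    simp only [F, if_neg hp]
    simp
  let c : Fin n → Fin m := Fin.castLE hnm
  have hc : Function.Injective c := Fin.castLE_injective hnm
  let a₀ : σ → ℂ := fun p => if p.1.2 = Finsupp.single (c p.1.1) 1 then 1 else 0
  let z₀ : σ ⊕ Fin m → ℂ := Sum.elim a₀ 0
  have hprod0 : ∀ s : Fin m →₀ ℕ, s ≠ 0 → ∏ j, (0 : ℂ) ^ s j = 0 := by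
    intro s hs
    obtain ⟨j, hj⟩ := Finsupp.ne_iff.mp hs
    exact Finset.prod_eq_zero (Finset.mem_univ j) (zero_pow (by simpa using hj))
  have hinj : Function.Injective (aeval F : MvPolynomial σ ℂ →ₐ[ℂ] _) := by
    apply aux_dominant F z₀
    have hz0 : ∀ (z : σ ⊕ Fin m → ℂ), (∀ j, z (Sum.inr j) = 0) → ∀ p : σ, p.1.2 = 0 →
        eval z (F p) = 0 := by
      intro z hz p hp
      rw [hF0 z p hp, neg_eq_zero]
      refine Finset.sum_eq_zero fun s hs => ?_
      simp only [hz]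
      rw [hprod0 s (Finset.ne_of_mem_erase hs), mul_zero]
    intro u
    let w : Fin m → ℂ := fun j => ∑ i, if c i = j then
      (if h : (0 : Fin m →₀ ℕ) ∈ S i then - u ⟨(i, 0), h⟩ else 0) else 0
    have hw : ∀ p : σ, p.1.2 = 0 → w (c p.1.1) = - u p := by
      rintro ⟨⟨i, s⟩, h⟩ hp
      simp only at hp
      subst hp
      simp only [w, hc.eq_iff]
      simp only [Finset.sum_ite_eq', Finset.mem_univ, if_true]
      exact dif_pos h
    refine ⟨Sum.elim u 0, Sum.elim 0 w, fun p => if p.1.2 = 0 then 0 else u p,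
      fun p => if p.1.2 = 0 then u p else 0, ?_, ?_, ?_⟩
    · funext p
      by_cases hp : p.1.2 = 0 <;> simp [hp]
    · intro t p
      by_cases hp : p.1.2 = 0
      · rw [hz0 _ (by simp [z₀]) p hp, hz0 _ (by simp [z₀]) p hp]
        simp [hp]
      · rw [hF1 _ p hp, hF1 _ p hp]
        simp [hp]
    · intro t p
      by_cases hp : p.1.2 = 0
      · rw [hz0 z₀ (by simp [z₀]) p hp, hF0 _ p hp]
        have hmem : Finsupp.single (c p.1.1) 1 ∈ (S p.1.1).erase 0 := by
          rw [Finset.mem_erase, hS]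
          refine ⟨by simp, ?_⟩
          rw [Finsupp.sum_single_index rfl]
          exact hd _
        rw [Finset.sum_eq_single_of_mem _ hmem]
        · rw [hv _ _ (Finset.mem_of_mem_erase hmem)]
          rw [Finset.prod_eq_single (c p.1.1)]
          · simp [z₀, a₀, hp, hw p hp]
          · intro j _ hj
            simp [hj.symm]
          · simp
        · intro s hs hne
          rw [hv _ _ (Finset.mem_of_mem_erase hs)]
          simp [z₀, a₀, hne]
      · rw [hF1 _ p hp, hF1 _ p hp]
        simp [hp]
  obtain ⟨P, hP0, hP⟩ := aux_generic_surj (aeval F) hinj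
  refine ⟨rename Subtype.val P, ?_, ?_, ?_⟩
  · intro h
    exact hP0 (rename_injective _ Subtype.val_injective (by rw [h, map_zero]))
  · intro p hp
    obtain ⟨q, -, rfl⟩ := mem_vars_rename _ _ hp
    exact (hS _ _).mp q.2
  · intro f hf _ hne
    rw [eval_rename] at hne
    obtain ⟨z, hz⟩ := hP _ hne
    simp only [aeval_X, Function.comp_apply] at hz
    refine ⟨fun j => z (Sum.inr j), fun i => ?_⟩
    have hsub : (f i).support ⊆ S i := by
      intro s hs
      rw [hS]
      exact (le_totalDegree hs).trans (hf i)
    have h0 : (0 : Fin m →₀ ℕ) ∈ S i := by rw [hS]; simp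
    rw [eval_eq', Finset.sum_subset hsub (fun s _ hs => by
      rw [notMem_support_iff.mp hs, zero_mul]), ← Finset.add_sum_erase _ _ h0]
    have h1 := hz ⟨(i, 0), h0⟩
    rw [hF0 _ _ rfl] at h1
    simp only at h1
    rw [← h1]
    simp only [Finsupp.coe_zero, Pi.zero_apply, pow_zero, Finset.prod_const_one, mul_one]
    rw [neg_add_eq_zero]
    refine Finset.sum_congr rfl fun s hs => ?_
    have hs' := Finset.mem_of_mem_erase hs
    rw [hv _ _ hs', ← hF1 z ⟨(i, s), hs'⟩ (Finset.ne_of_mem_erase hs), hz]
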